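/- Assume MA_ctble. Then there exists a rapid nonprincipal ultrafilter 𝒰 on ℕ that contains only AP-sets, i.e. every member of 𝒰 is an AP-set. -/

import Mathlib

open Set Filter Cardinal

/-- A set `A ⊆ ℕ` is an AP-set if it contains arithmetic progressions of every finite length. -/
def IsAPSet (A : Set ℕ) : Prop :=
  ∀ k : ℕ, ∃ a d : ℕ, 1 ≤ d ∧ ∀ i < k, a + i * d ∈ A

/-- `A` contains a 3-term arithmetic progression `{a, a+d, a+2d}` with `d ≥ 1`. -/
def Has3AP (A : Set ℕ) : Prop :=
  ∃ a d : ℕ, 1 ≤ d ∧ a ∈ A ∧ a + d ∈ A ∧ a + 2 * d ∈ A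

/-- `f` is finite-to-one: each fiber is finite. -/
def FiniteToOne (f : ℕ → ℕ) : Prop := ∀ m : ℕ, (f ⁻¹' {m}).Finite

/-- A nonprincipal ultrafilter `𝒰` on ℕ is a Q-point if for every partition of ℕ into finite
sets there is a member of `𝒰` meeting each piece in at most one point. -/
def IsQPoint (𝒰 : Ultrafilter ℕ) : Prop :=
  (∀ a : ℕ, 𝒰 ≠ pure a) ∧
    ∀ Q : ℕ → Set ℕ, (∀ n, (Q n).Finite) →
      (∀ m n, m ≠ n → Disjoint (Q m) (Q n)) → (⋃ n, Q n) = Set.univ →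
      ∃ A ∈ 𝒰, ∀ n, (A ∩ Q n).Subsingleton

/-- A filter base on ℕ. -/
def IsFilterBase (𝓕 : Set (Set ℕ)) : Prop :=
  𝓕.Nonempty ∧ ∀ A ∈ 𝓕, ∀ B ∈ 𝓕, ∃ C ∈ 𝓕, C ⊆ A ∩ B

/-- Property (♠): every member of the family has at least `k` elements in some dyadic
interval `[2ⁿ, 2ⁿ⁺¹)`, for every `k`. -/
def Spade (𝓕 : Set (Set ℕ)) : Prop :=
  ∀ F ∈ 𝓕, ∀ k : ℕ, ∃ n : ℕ, k ≤ (F ∩ Set.Ico (2 ^ n) (2 ^ (n + 1))).ncard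

/-- A dense subset of a poset. -/
def PosetDense {P : Type} [PartialOrder P] (D : Set P) : Prop :=
  ∀ p : P, ∃ q ∈ D, q ≤ p

/-- A filter on a poset: nonempty, upward closed, downward directed. -/
def PosetFilter {P : Type} [PartialOrder P] (G : Set P) : Prop :=
  G.Nonempty ∧ (∀ p ∈ G, ∀ q, p ≤ q → q ∈ G) ∧
    ∀ p ∈ G, ∀ q ∈ G, ∃ r ∈ G, r ≤ p ∧ r ≤ q

/-- Martin's axiom for countable posets. -/
def MActble : Prop :=
  ∀ (P : Type) [PartialOrder P] [Countable P] [Nonempty P],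
    ∀ 𝒟 : Set (Set P), (∀ D ∈ 𝒟, PosetDense D) → #𝒟 < Cardinal.continuum →
      ∃ G : Set P, PosetFilter G ∧ ∀ D ∈ 𝒟, (G ∩ D).Nonempty

/-- A rapid ultrafilter: the enumeration functions of its members form a dominating family. -/
def IsRapid (𝒰 : Ultrafilter ℕ) : Prop :=
  ∀ h : ℕ → ℕ, ∃ B ∈ 𝒰, B.Infinite ∧ ∀ᶠ n in Filter.atTop, h n ≤ Nat.nth (· ∈ B) n

/-- A hereditarily rapid ultrafilter: all its images under maps `ℕ → ℕ` are rapid. -/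
def IsHereditarilyRapid (𝒰 : Ultrafilter ℕ) : Prop :=
  IsRapid 𝒰 ∧ ∀ f : ℕ → ℕ, IsRapid (Ultrafilter.map f 𝒰)

lemma IsAPSet.mono {A B : Set ℕ} (hA : IsAPSet A) (h : A ⊆ B) : IsAPSet B := by
  intro k
  obtain ⟨a, d, hd, hi⟩ := hA k
  exact ⟨a, d, hd, fun i hik => h (hi i hik)⟩

lemma isAPSet_univ : IsAPSet Set.univ := fun _ => ⟨0, 1, le_rfl, fun _ _ => Set.mem_univ _⟩

lemma not_isAPSet_empty : ¬ IsAPSet ∅ := by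
  intro h
  obtain ⟨a, d, -, hi⟩ := h 1
  exact hi 0 one_pos

lemma not_isAPSet_singleton (a : ℕ) : ¬ IsAPSet {a} := by
  intro h
  obtain ⟨b, d, hd, hi⟩ := h 2
  have h0 := hi 0 (by norm_num)
  have h1 := hi 1 (by norm_num)
  simp only [Set.mem_singleton_iff] at h0 h1
  omega

/-- An AP-set contains arbitrarily long progressions beyond any given bound. -/
lemma IsAPSet.exists_ge {A : Set ℕ} (hA : IsAPSet A) (k M : ℕ) :
    ∃ a d : ℕ, 1 ≤ d ∧ M ≤ a ∧ ∀ i < k, a + i * d ∈ A := by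
  obtain ⟨a, d, hd, hi⟩ := hA (M + k)
  refine ⟨a + M * d, d, hd, ?_, fun i hik => ?_⟩
  · nlinarith
  · have := hi (M + i) (by omega)
    rwa [show a + (M + i) * d = a + M * d + i * d by ring] at this

lemma IsAPSet.infinite {A : Set ℕ} (hA : IsAPSet A) : A.Infinite := by
  refine Set.infinite_of_forall_exists_gt fun M => ?_
  obtain ⟨a, d, -, hM, hi⟩ := hA.exists_ge 1 (M + 1)
  exact ⟨a + 0 * d, hi 0 one_pos, by omega⟩

/-- Van der Waerden's theorem: AP-sets are partition regular. -/
lemma IsAPSet.of_union {A B : Set ℕ} (h : IsAPSet (A ∪ B)) : IsAPSet A ∨ IsAPSet B := by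
  classical
  by_contra! hcon
  obtain ⟨hA, hB⟩ := hcon
  unfold IsAPSet at hA hB
  push Not at hA hB
  obtain ⟨k₁, hA⟩ := hA
  obtain ⟨k₂, hB⟩ := hB
  set k := max k₁ k₂ + 1 with hk
  obtain ⟨ι, _, hι⟩ := Combinatorics.Line.exists_mono_in_high_dimension (Fin k) Prop
  obtain ⟨a, d, hd, hi⟩ := h (Fintype.card ι * k + 1)
  obtain ⟨l, c, hl⟩ := hι fun v => a + (∑ j, (v j : ℕ)) * d ∈ A
  set m := (Finset.univ.filter fun j => l.idxFun j = none).card with hm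
  have hm1 : 1 ≤ m := by
    obtain ⟨j, hj⟩ := l.proper
    exact Finset.card_pos.2 ⟨j, by simp [hj]⟩
  have hsum : ∀ x : Fin k, ∑ j, (l x j : ℕ) = (∑ j, (l 0 j : ℕ)) + x * m := by
    intro x
    rw [hm, Finset.card_filter, Finset.mul_sum, ← Finset.sum_add_distrib]
    refine Finset.sum_congr rfl fun j _ => ?_
    rcases hj : l.idxFun j with _ | y
    · simp [hj]
    · simp [hj]
  have hpt : ∀ i (hik : i < k), a + (∑ j, (l ⟨i, hik⟩ j : ℕ)) * d =
      a + (∑ j, (l 0 j : ℕ)) * d + i * (m * d) := by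
    intro i hik
    rw [hsum]
    ring
  have hbound : ∀ x : Fin k, ∑ j, (l x j : ℕ) < Fintype.card ι * k + 1 := by
    intro x
    have : ∑ j, (l x j : ℕ) ≤ ∑ _j : ι, k := Finset.sum_le_sum fun j _ => (l x j).2.le
    rw [Finset.sum_const, Finset.card_univ, smul_eq_mul] at this
    omega
  have hd' : 1 ≤ m * d := Nat.mul_pos hm1 hd
  by_cases hc : c
  · obtain ⟨i, hik, hni⟩ := hA (a + (∑ j, (l 0 j : ℕ)) * d) (m * d) hd'
    have hik' : i < k := by omega
    rw [← hpt i hik'] at hni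
    exact hni ((hl ⟨i, hik'⟩).mpr hc)
  · obtain ⟨i, hik, hni⟩ := hB (a + (∑ j, (l 0 j : ℕ)) * d) (m * d) hd'
    have hik' : i < k := by omega
    rw [← hpt i hik'] at hni
    rcases hi _ (hbound ⟨i, hik'⟩) with h1 | h1
    · exact hc ((hl ⟨i, hik'⟩).mp h1)
    · exact hni h1

open Classical in
/-- Every element of `B` dominates the value of `h` at its position in `B`. -/
def SparseFor (h : ℕ → ℕ) (B : Set ℕ) : Prop :=
  ∀ x ∈ B, h (Nat.count (· ∈ B) x) ≤ x

open Classical in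
lemma SparseFor.le_nth {h : ℕ → ℕ} {B : Set ℕ} (hB : SparseFor h B) (hinf : B.Infinite) (n : ℕ) :
    h n ≤ Nat.nth (· ∈ B) n := by
  have h1 := hB _ (Nat.nth_mem_of_infinite (p := (· ∈ B)) hinf n)
  rwa [Nat.count_nth_of_infinite (p := (· ∈ B)) hinf] at h1

open Classical in
lemma count_congr_of_lt {A B : Set ℕ} {x : ℕ} (h : ∀ y < x, y ∈ A ↔ y ∈ B) :
    Nat.count (· ∈ A) x = Nat.count (· ∈ B) x := by
  rw [Nat.count_eq_card_filter_range, Nat.count_eq_card_filter_range]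
  congr 1
  exact Finset.filter_congr fun y hy => h y (Finset.mem_range.1 hy)

open Classical in
lemma count_le_card_of_subset {B : Set ℕ} {t : Finset ℕ} (hB : B ⊆ t) (x : ℕ) :
    Nat.count (· ∈ B) x ≤ t.card := by
  rw [Nat.count_eq_card_filter_range]
  exact Finset.card_le_card fun y hy => Finset.mem_coe.1 (hB (Finset.mem_filter.1 hy).2)

/-- A finite set that is sparse for `h` can be extended by a long progression from any AP-set. -/
lemma SparseFor.exists_extension {h : ℕ → ℕ} {s : Finset ℕ} (hs : SparseFor h s) {F : Set ℕ}
    (hF : IsAPSet F) (k : ℕ) :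
    ∃ t : Finset ℕ, SparseFor h t ∧ s ⊆ t ∧
      ∃ a d : ℕ, 1 ≤ d ∧ ∀ i < k, a + i * d ∈ (t : Set ℕ) ∩ F := by
  classical
  obtain ⟨a, d, hd, hM, hi⟩ := hF.exists_ge k
    (s.sup id + 1 + (Finset.range (s.card + k + 1)).sup h)
  set P := (Finset.range k).image fun i => a + i * d with hP
  have hPa : ∀ x ∈ P, a ≤ x := by
    intro x hx
    obtain ⟨i, -, rfl⟩ := Finset.mem_image.1 hx
    omega
  have hsa : ∀ x ∈ s, x < a := by
    intro x hx
    have : x ≤ s.sup id := Finset.le_sup (f := id) hx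
    omega
  refine ⟨s ∪ P, ?_, Finset.subset_union_left, a, d, hd, fun i hik => ⟨?_, hi i hik⟩⟩
  · intro x hx
    rcases Finset.mem_union.1 (Finset.mem_coe.1 hx) with hx | hx
    · rw [count_congr_of_lt (B := (s : Set ℕ))]
      · exact hs x hx
      · intro y hy
        simp only [Finset.coe_union, Set.mem_union, Finset.mem_coe, or_iff_left_iff_imp]
        intro hyP
        have := hPa y hyP
        have := hsa x hx
        omega
    · have hcard : (s ∪ P).card ≤ s.card + k := by
        refine (Finset.card_union_le _ _).trans ?_
        have : P.card ≤ k := Finset.card_image_le.trans (by simp)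
        omega
      have hcount := (count_le_card_of_subset (subset_refl ((s ∪ P : Finset ℕ) : Set ℕ)) x).trans hcard
      have := hPa x hx
      have hle := Finset.le_sup (f := h) (Finset.mem_range.2 (Nat.lt_succ_of_le hcount))
      have hx' : (Finset.range (s.card + k).succ).sup h ≤ x := by
        rw [Nat.succ_eq_add_one]
        omega
      exact hle.trans hx'
  · exact Finset.mem_coe.2 (Finset.mem_union_right _
      (Finset.mem_image_of_mem _ (Finset.mem_range.2 hik)))

lemma exists_sparseFor_of_MActble (hMA : MActble) (h : ℕ → ℕ) (𝓕 : Set (Set ℕ))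
    (hcard : #𝓕 < Cardinal.continuum) (hAP : ∀ F ∈ 𝓕, IsAPSet F) :
    ∃ B : Set ℕ, SparseFor h B ∧ ∀ F ∈ 𝓕, IsAPSet (B ∩ F) := by
  classical
  let P : Type := {s : (Finset ℕ)ᵒᵈ // SparseFor h (OrderDual.ofDual s : Finset ℕ)}
  have : Countable (Finset ℕ)ᵒᵈ := inferInstanceAs (Countable (Finset ℕ))
  have : Countable P := inferInstanceAs (Countable {s : (Finset ℕ)ᵒᵈ // _})
  have : Nonempty P := ⟨⟨OrderDual.toDual ∅, by intro x hx; simp at hx⟩⟩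
  let S : P → Set ℕ := fun p => (OrderDual.ofDual p.1 : Finset ℕ)
  have hle : ∀ p q : P, q ≤ p ↔ S p ⊆ S q := fun p q => Finset.coe_subset.symm
  let D : 𝓕 × ℕ → Set P := fun x =>
    {p | ∃ a d : ℕ, 1 ≤ d ∧ ∀ i < x.2, a + i * d ∈ S p ∩ x.1}
  have hD : #(Set.range D) < Cardinal.continuum := by
    refine Cardinal.mk_range_le.trans_lt ?_
    rw [Cardinal.mk_prod, Cardinal.lift_id, Cardinal.lift_id, Cardinal.mk_nat]
    exact Cardinal.mul_lt_of_lt Cardinal.aleph0_le_continuum hcard Cardinal.aleph0_lt_continuum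
  have hdense : ∀ E ∈ Set.range D, PosetDense E := by
    rintro _ ⟨⟨F, k⟩, rfl⟩ p
    obtain ⟨t, ht, hst, hprog⟩ := p.2.exists_extension (hAP F F.2) k
    exact ⟨⟨OrderDual.toDual t, ht⟩, hprog, (hle _ _).2 (Finset.coe_subset.2 hst)⟩
  obtain ⟨G, ⟨hne, -, hdir⟩, hG⟩ := hMA P (Set.range D) hdense hD
  have hfin : ∀ T : Finset ℕ, ∃ p ∈ G, ∀ y ∈ T, (∃ q ∈ G, y ∈ S q) → y ∈ S p := by
    intro T
    induction T using Finset.induction_on with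
    | empty =>
      obtain ⟨p, hp⟩ := hne
      exact ⟨p, hp, by simp⟩
    | insert z T _ ih =>
      obtain ⟨p, hp, hpT⟩ := ih
      by_cases hz : ∃ q ∈ G, z ∈ S q
      · obtain ⟨q, hq, hzq⟩ := hz
        obtain ⟨r, hr, hrp, hrq⟩ := hdir p hp q hq
        refine ⟨r, hr, fun y hy hyG => ?_⟩
        rcases Finset.mem_insert.1 hy with rfl | hy
        · exact (hle _ _).1 hrq hzq
        · exact (hle _ _).1 hrp (hpT y hy hyG)
      · refine ⟨p, hp, fun y hy hyG => ?_⟩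
        rcases Finset.mem_insert.1 hy with rfl | hy
        · exact absurd hyG hz
        · exact hpT y hy hyG
  refine ⟨{y | ∃ q ∈ G, y ∈ S q}, fun x hx => ?_, fun F hF k => ?_⟩
  · obtain ⟨p, hp, hpx⟩ := hfin (Finset.range (x + 1))
    rw [count_congr_of_lt (B := S p)]
    · exact p.2 x (hpx x (by simp) hx)
    · exact fun y hy => ⟨hpx y (Finset.mem_range.2 (by omega)), fun hyp => ⟨p, hp, hyp⟩⟩
  · obtain ⟨p, hpG, a, d, hd, hi⟩ := hG _ ⟨(⟨F, hF⟩, k), rfl⟩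
    exact ⟨a, d, hd, fun i hik => ⟨⟨p, hpG, (hi i hik).1⟩, (hi i hik).2⟩⟩

lemma mk_finset_lt_continuum {α : Type} (hα : #α < Cardinal.continuum) :
    #(Finset α) < Cardinal.continuum := by
  cases finite_or_infinite α
  · exact (Cardinal.mk_le_aleph0).trans_lt Cardinal.aleph0_lt_continuum
  · rwa [Cardinal.mk_finset_of_infinite]

/-- Under MA for countable posets there is a family of sparse sets, one for each function, all of
whose finite intersections are AP-sets. -/
lemma exists_sparseFor_family (hMA : MActble) :
    ∃ f : (ℕ → ℕ) → Set ℕ, (∀ h, SparseFor h (f h)) ∧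
      ∀ T : Finset (ℕ → ℕ), IsAPSet (⋂ h ∈ T, f h) := by
  classical
  let X : Type := Cardinal.continuum.ord.ToType
  obtain ⟨e⟩ : Nonempty (X ≃ (ℕ → ℕ)) := by
    rw [← Cardinal.eq]
    simp [X]
  have step : ∀ (x : X) (S : X → Set ℕ),
      (∀ T : Finset X, (∀ y ∈ T, y < x) → IsAPSet (⋂ y ∈ T, S y)) →
      ∃ B, SparseFor (e x) B ∧
        ∀ T : Finset X, (∀ y ∈ T, y < x) → IsAPSet (B ∩ ⋂ y ∈ T, S y) := by
    intro x S hS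
    let I : Finset (Set.Iio x) → Set ℕ := fun T => ⋂ y ∈ T.map (Function.Embedding.subtype _), S y
    obtain ⟨B, hB, hBF⟩ := exists_sparseFor_of_MActble hMA (e x) (Set.range I)
      (Cardinal.mk_range_le.trans_lt
        (mk_finset_lt_continuum (by simpa [X] using Cardinal.mk_Iio_lt x (by simp [X])))) (by
          rintro _ ⟨T, rfl⟩
          refine hS _ fun y hy => ?_
          obtain ⟨z, -, rfl⟩ := Finset.mem_map.1 hy
          exact z.2)
    refine ⟨B, hB, fun T hT => ?_⟩
    have := hBF _ ⟨T.subtype (· ∈ Set.Iio x), rfl⟩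
    have hmap : (T.subtype (· ∈ Set.Iio x)).map (Function.Embedding.subtype _) = T :=
      Finset.subtype_map_of_mem hT
    simp only [I] at this
    rwa [hmap] at this
  choose! N hN using step
  let f : X → Set ℕ := (wellFounded_lt (α := X)).fix fun x g =>
    N x fun y => if hy : y < x then g y hy else Set.univ
  have hf : ∀ x, f x = N x fun y => if y < x then f y else Set.univ := by
    intro x
    simp only [f]
    rw [WellFounded.fix_eq]
    simp only [dite_eq_ite]
  have hmax : ∀ T : Finset X, (∀ x ∈ T, ∀ T' : Finset X, (∀ y ∈ T', y < x) →
      IsAPSet (f x ∩ ⋂ y ∈ T', f y)) → IsAPSet (⋂ y ∈ T, f y) := by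
    intro T hT
    rcases T.eq_empty_or_nonempty with rfl | hne
    · simpa using isAPSet_univ
    · have hm := T.max'_mem hne
      have := hT _ hm (T.erase (T.max' hne)) fun y hy => T.lt_max'_of_mem_erase_max' hne hy
      rwa [← Finset.set_biInter_insert, Finset.insert_erase hm] at this
  have key : ∀ x, SparseFor (e x) (f x) ∧
      ∀ T : Finset X, (∀ y ∈ T, y < x) → IsAPSet (f x ∩ ⋂ y ∈ T, f y) := by
    intro x
    induction x using WellFoundedLT.induction with
    | ind x ih =>
      have hcongr : ∀ T : Finset X, (∀ y ∈ T, y < x) →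
          ⋂ y ∈ T, (if y < x then f y else Set.univ) = ⋂ y ∈ T, f y :=
        fun T hT => Set.iInter₂_congr fun y hy => if_pos (hT y hy)
      have hx := hN x (fun y => if y < x then f y else Set.univ) fun T hT => by
        rw [hcongr T hT]
        exact hmax T fun y hy => (ih y (hT y hy)).2
      rw [← hf x] at hx
      refine ⟨hx.1, fun T hT => ?_⟩
      rw [← hcongr T hT]
      exact hx.2 T hT
  refine ⟨fun h => f (e.symm h), fun h => by simpa using (key (e.symm h)).1, fun T => ?_⟩
  simpa using hmax (T.image e.symm) fun x _ => (key x).2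

/-- Under MA_ctble there is a rapid ultrafilter containing only AP-sets. -/
theorem exists_rapid_with_only_APsets (hMA : MActble) :
    ∃ 𝒰 : Ultrafilter ℕ, (∀ a : ℕ, 𝒰 ≠ pure a) ∧ IsRapid 𝒰 ∧ ∀ U ∈ 𝒰, IsAPSet U := by
  classical
  obtain ⟨f, hsparse, hAP⟩ := exists_sparseFor_family hMA
  let L : Filter ℕ :=
    { sets := {U | ∃ T : Finset (ℕ → ℕ), ¬ IsAPSet ((⋂ h ∈ T, f h) \ U)}
      univ_sets := ⟨∅, by simpa using not_isAPSet_empty⟩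
      sets_of_superset := by
        rintro U V ⟨T, hT⟩ hUV
        exact ⟨T, fun h => hT (h.mono (Set.sdiff_subset_sdiff_right hUV))⟩
      inter_sets := by
        rintro U V ⟨T₁, h₁⟩ ⟨T₂, h₂⟩
        refine ⟨T₁ ∪ T₂, fun h => ?_⟩
        rw [Set.sdiff_inter] at h
        rcases h.of_union with h | h
        · exact h₁ (h.mono (Set.sdiff_subset_sdiff_left
            (Set.biInter_subset_biInter_left fun _ => Finset.mem_union_left _)))
        · exact h₂ (h.mono (Set.sdiff_subset_sdiff_left
            (Set.biInter_subset_biInter_left fun _ => Finset.mem_union_right _))) }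
  have : L.NeBot := by
    refine Filter.neBot_iff.2 fun hbot => ?_
    obtain ⟨T, hT⟩ := Filter.empty_mem_iff_bot.2 hbot
    exact hT (by simpa using hAP T)
  have hfL : ∀ h, f h ∈ L := fun h => ⟨{h}, by simpa using not_isAPSet_empty⟩
  have hU : ∀ U ∈ Ultrafilter.of L, IsAPSet U := by
    intro U hU
    by_contra hcon
    have hc : Uᶜ ∈ L := ⟨∅, by simpa using hcon⟩
    exact Ultrafilter.compl_notMem_iff.2 hU (Ultrafilter.of_le L hc)
  refine ⟨Ultrafilter.of L, fun a ha => not_isAPSet_singleton a (hU _ ?_), fun h => ?_, hU⟩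
  · rw [ha]
    exact Ultrafilter.mem_pure.2 rfl
  · have hinf := (hU _ (Ultrafilter.of_le L (hfL h))).infinite
    exact ⟨f h, Ultrafilter.of_le L (hfL h), hinf,
      Filter.Eventually.of_forall fun n => (hsparse h).le_nth hinf n⟩
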